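/- arXiv:math/0511278 — 2 statements merged into one kernel-verified Lean document; each statement's English description precedes it below -/
import Mathlib

section
/- Let A be an N×N Hermitian complex matrix and let k be an integer with 1 ≤ k and 2k − 1 ≤ N. Then the rank-k numerical range Λ_k(A) is non-empty. -/
open Matrix Complex

/-- The rank-k numerical range of a square complex matrix `T`:
all `λ ∈ ℂ` such that `P T P = λ P` for some orthogonal projection `P` of rank `k`. -/
def rankKRange {n : Type*} [Fintype n] [DecidableEq n]
    (k : ℕ) (T : Matrix n n ℂ) : Set ℂ :=
  {lam : ℂ | ∃ P : Matrix n n ℂ,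
    P.IsHermitian ∧ P * P = P ∧ P.rank = k ∧ P * T * P = lam • P}

open scoped ComplexOrder in
lemma mem_of_isometry {N k : ℕ} (A : Matrix (Fin N) (Fin N) ℂ) (V : Matrix (Fin N) (Fin k) ℂ)
    (c : ℂ) (h1 : Vᴴ * V = 1) (h2 : Vᴴ * A * V = c • (1 : Matrix (Fin k) (Fin k) ℂ)) :
    c ∈ rankKRange k A := by
  refine ⟨V * Vᴴ, ?_, ?_, ?_, ?_⟩
  · exact Matrix.isHermitian_mul_conjTranspose_self V
  · calc V * Vᴴ * (V * Vᴴ) = V * (Vᴴ * V) * Vᴴ := by simp only [Matrix.mul_assoc]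
      _ = V * Vᴴ := by rw [h1, Matrix.mul_one]
  · rw [Matrix.rank_self_mul_conjTranspose, ← Matrix.rank_conjTranspose_mul_self, h1]
    simp
  · calc V * Vᴴ * A * (V * Vᴴ) = V * (Vᴴ * A * V) * Vᴴ := by simp only [Matrix.mul_assoc]
      _ = c • (V * Vᴴ) := by rw [h2]; simp

lemma exists_weights (x y c : ℝ) (h1 : x ≤ c) (h2 : c ≤ y) :
    ∃ s t : ℝ, s * s + t * t = 1 ∧ s * s * x + t * t * y = c := by
  by_cases h : x = y
  · exact ⟨1, 0, by norm_num, by linarith⟩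
  · have hxy : 0 < y - x := by
      rcases lt_or_eq_of_le (h1.trans h2) with h' | h'
      · linarith
      · exact absurd h' h
    refine ⟨Real.sqrt ((y - c) / (y - x)), Real.sqrt ((c - x) / (y - x)), ?_, ?_⟩
    all_goals
      rw [Real.mul_self_sqrt (div_nonneg (by linarith) hxy.le),
        Real.mul_self_sqrt (div_nonneg (by linarith) hxy.le)]
      field_simp
      ring

lemma gram_entry {N k : ℕ} (a b : Fin k → Fin N) (s t : Fin k → ℝ)
    (ha : Function.Injective a) (hb : Function.Injective b)
    (hab : ∀ j l, a j = b l → j = l ∧ t l = 0) (f : Fin N → ℝ) (j l : Fin k) :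
    ∑ i, ((if i = a j then s j else 0) + (if i = b j then t j else 0)) * f i *
      ((if i = a l then s l else 0) + (if i = b l then t l else 0)) =
    if j = l then s j * s j * f (a j) + t j * t j * f (b j) else 0 := by
  simp only [add_mul, ite_mul, zero_mul, Finset.sum_add_distrib, Finset.sum_ite_eq', Finset.mem_univ, if_true]
  by_cases h : j = l
  · subst h
    by_cases h' : a j = b j
    · have := (hab _ _ h').2
      simp [this]
      ring
    · simp [h', Ne.symm h']
      ring
  · have e1 : a j ≠ a l := fun e => h (ha e)
    have e2 : b j ≠ b l := fun e => h (hb e)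
    have e3 : a j ≠ b l := fun e => h (hab _ _ e).1
    have e4 : b j ≠ a l := fun e => h (hab _ _ e.symm).1.symm
    simp [e1, e2, e3, e4, h]

lemma diag_case {N k : ℕ} (hk : 1 ≤ k) (hkN : 2 * k - 1 ≤ N) (d : Fin N → ℝ) :
    ∃ (W : Matrix (Fin N) (Fin k) ℂ) (c : ℂ), Wᴴ * W = 1 ∧
      Wᴴ * diagonal (fun i => (d i : ℂ)) * W = c • (1 : Matrix (Fin k) (Fin k) ℂ) := by
  have hm : Monotone (d ∘ Tuple.sort d) := Tuple.monotone_sort d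
  set σ := Tuple.sort d
  let a : Fin k → Fin N := fun j => σ ⟨j, by omega⟩
  let b : Fin k → Fin N := fun j => σ ⟨2 * k - 2 - j, by omega⟩
  let c : ℝ := d (σ ⟨k - 1, by omega⟩)
  have hst : ∀ j : Fin k, ∃ s t : ℝ, s * s + t * t = 1 ∧
      s * s * d (a j) + t * t * d (b j) = c ∧ ((j : ℕ) = k - 1 → t = 0) := by
    intro j
    by_cases hj : (j : ℕ) = k - 1
    · exact ⟨1, 0, by norm_num, by simp [a, c, hj], fun _ => rfl⟩
    · obtain ⟨s, t, h1, h2⟩ := exists_weights (d (a j)) (d (b j)) c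
        (hm (by rw [Fin.mk_le_mk]; omega)) (hm (by rw [Fin.mk_le_mk]; omega))
      exact ⟨s, t, h1, h2, fun h => absurd h hj⟩
  choose s t h1 h2 h3 using hst
  have ha : Function.Injective a := fun j l h => by
    have := σ.injective h
    rw [Fin.mk.injEq] at this
    exact Fin.ext this
  have hb : Function.Injective b := fun j l h => by
    have := σ.injective h
    rw [Fin.mk.injEq] at this
    exact Fin.ext (by omega)
  have hab : ∀ j l, a j = b l → j = l ∧ t l = 0 := fun j l h => by
    have := σ.injective h
    rw [Fin.mk.injEq] at this
    exact ⟨Fin.ext (by omega), h3 l (by omega)⟩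
  have key := gram_entry a b s t ha hb hab
  let R : Matrix (Fin N) (Fin k) ℝ :=
    fun i j => (if i = a j then s j else 0) + (if i = b j then t j else 0)
  have hR : ∀ f : Fin N → ℝ, ∀ c : ℝ,
      (∀ j, s j * s j * f (a j) + t j * t j * f (b j) = c) →
      (R.map (fun x : ℝ => (x : ℂ)))ᴴ * diagonal (fun i => (f i : ℂ)) *
        R.map (fun x : ℝ => (x : ℂ)) = (c : ℂ) • (1 : Matrix (Fin k) (Fin k) ℂ) := by
    intro f c hf
    ext j l
    have := congrArg (fun x : ℝ => (x : ℂ)) (key f j l)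
    rw [hf] at this
    rw [Matrix.mul_apply]
    simp only [Matrix.mul_diagonal, Matrix.conjTranspose_apply, Matrix.map_apply,
      Matrix.smul_apply, Matrix.one_apply, smul_eq_mul, Complex.star_def, Complex.conj_ofReal]
    have e : (∑ i, (R i j : ℂ) * (f i : ℂ) * (R i l : ℂ)) =
        ((∑ i, R i j * f i * R i l : ℝ) : ℂ) := by push_cast; rfl
    rw [e]
    refine this.trans ?_
    split_ifs <;> simp
  refine ⟨R.map (fun x : ℝ => (x : ℂ)), (c : ℂ), ?_, hR d c h2⟩
  have := hR (fun _ => 1) 1 (fun j => by simpa using h1 j)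
  simpa using this

/-- for Hermitian A and 2k − 1 ≤ N, Λ_k(A) is non-empty. -/
theorem rankKRange_hermitian_nonempty (N k : ℕ) (hk : 1 ≤ k) (hkN : 2 * k - 1 ≤ N)
    (A : Matrix (Fin N) (Fin N) ℂ) (hA : A.IsHermitian) :
    (rankKRange k A).Nonempty := by
  obtain ⟨W, c, h1, h2⟩ := diag_case hk hkN hA.eigenvalues
  have hs := hA.spectral_theorem
  rw [Unitary.conjStarAlgAut_apply] at hs
  have hU : (hA.eigenvectorUnitary : Matrix (Fin N) (Fin N) ℂ)ᴴ * hA.eigenvectorUnitary = 1 :=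
    Unitary.coe_star_mul_self hA.eigenvectorUnitary
  set U : Matrix (Fin N) (Fin N) ℂ := (hA.eigenvectorUnitary).1
  have hs' : A = U * diagonal (fun i => (hA.eigenvalues i : ℂ)) * Uᴴ := hs
  generalize diagonal (fun i => (hA.eigenvalues i : ℂ)) = D at h2 hs'
  refine ⟨c, mem_of_isometry A (U * W) c ?_ ?_⟩
  · calc (U * W)ᴴ * (U * W) = Wᴴ * (Uᴴ * U) * W := by
          simp only [Matrix.conjTranspose_mul, Matrix.mul_assoc]
      _ = 1 := by rw [hU, Matrix.mul_one, h1]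
  · calc (U * W)ᴴ * A * (U * W) = (U * W)ᴴ * (U * D * Uᴴ) * (U * W) := by rw [← hs']
      _ = Wᴴ * (Uᴴ * U) * D * (Uᴴ * U) * W := by
          simp only [Matrix.conjTranspose_mul, Matrix.mul_assoc]
      _ = _ := by rw [hU, Matrix.mul_one, Matrix.mul_one, h2]
end

section
/- Let T be an arbitrary N×N complex matrix and let k be a positive integer satisfying 4k − 3 ≤ N. Then the rank-k numerical range Λ_k(T) is non-empty. -/
open Matrix Complex

lemma aux_sum {n m : ℕ} (p q : Fin m → Fin n) (c s : Fin m → ℂ)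
    (hp : Function.Injective p) (hq : Function.Injective q)
    (hpq : ∀ j l, p j = q l → j = l ∧ s j = 0) (f : Fin n → ℂ) (j l : Fin m) :
    ∑ i, ((if i = p j then c j else 0) + (if i = q j then s j else 0)) * f i *
      ((if i = p l then c l else 0) + (if i = q l then s l else 0)) =
      if j = l then c j ^ 2 * f (p j) + s j ^ 2 * f (q j) else 0 := by
  simp only [add_mul, ite_mul, zero_mul, Finset.sum_add_distrib, Finset.sum_ite_eq',
    Finset.mem_univ, if_true]
  by_cases h : j = l
  · subst h
    by_cases h2 : p j = q j
    · have := (hpq j j h2).2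
      simp [this]; ring
    · simp [h2, Ne.symm h2]; ring
  · have h1 : p j ≠ p l := fun e => h (hp e)
    have h2 : q j ≠ q l := fun e => h (hq e)
    have h3 : p j ≠ q l := fun e => h (hpq _ _ e).1
    have h4 : q j ≠ p l := fun e => h (hpq _ _ e.symm).1.symm
    simp [h, h1, h2, h3, h4]

lemma aux_cs (x y a : ℝ) (h1 : x ≤ a) (h2 : a ≤ y) :
    ∃ c s : ℝ, c ^ 2 + s ^ 2 = 1 ∧ c ^ 2 * x + s ^ 2 * y = a ∧ (x = a → s = 0) := by
  rcases h1.eq_or_lt with h | h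
  · exact ⟨1, 0, by simp, by simp [h], by simp⟩
  · have hxy : 0 < y - x := by linarith
    refine ⟨√((y - a) / (y - x)), √((a - x) / (y - x)), ?_, ?_, fun e => absurd e h.ne⟩
    · rw [Real.sq_sqrt (div_nonneg (by linarith) hxy.le),
        Real.sq_sqrt (div_nonneg (by linarith) hxy.le)]
      field_simp; ring
    · rw [Real.sq_sqrt (div_nonneg (by linarith) hxy.le),
        Real.sq_sqrt (div_nonneg (by linarith) hxy.le)]
      field_simp; ring

lemma aux_diag {n m : ℕ} (hm : 1 ≤ m) (hmn : 2 * m ≤ n + 1) (d : Fin n → ℝ) :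
    ∃ (W : Matrix (Fin n) (Fin m) ℂ) (a : ℝ), Wᴴ * W = 1 ∧
      Wᴴ * diagonal (fun i => (d i : ℂ)) * W = (a : ℂ) • 1 := by
  have hle : m ≤ n := by omega
  set σ := Tuple.sort d
  have hmono : Monotone (d ∘ σ) := Tuple.monotone_sort d
  let p : Fin m → Fin n := fun j => σ (Fin.castLE hle j)
  let q : Fin m → Fin n := fun j => σ (Fin.rev (Fin.castLE hle j))
  let a : ℝ := d (σ ⟨m - 1, by omega⟩)
  have key : ∀ j, ∃ c s : ℝ, c ^ 2 + s ^ 2 = 1 ∧ c ^ 2 * d (p j) + s ^ 2 * d (q j) = a ∧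
      (d (p j) = a → s = 0) := by
    intro j
    apply aux_cs
    · exact hmono (by rw [Fin.le_def]; simp; omega)
    · exact hmono (by rw [Fin.le_def]; simp [Fin.val_rev]; omega)
  choose c s h1 h2 h3 using key
  have hp : Function.Injective p := σ.injective.comp (Fin.castLE_injective hle)
  have hq : Function.Injective q :=
    σ.injective.comp (Fin.rev_injective.comp (Fin.castLE_injective hle))
  have hpq : ∀ j l, p j = q l → j = l ∧ (s j : ℂ) = 0 := by
    intro j l e
    have e' := congrArg Fin.val (σ.injective e)
    simp [Fin.val_rev] at e'
    have hj : (j : ℕ) = m - 1 := by omega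
    refine ⟨Fin.ext (by omega), ?_⟩
    have : s j = 0 := h3 j (by
      change d (σ _) = d (σ _)
      congr 2
      exact Fin.ext hj)
    simp [this]
  let W : Matrix (Fin n) (Fin m) ℂ := fun i j =>
    (if i = p j then (c j : ℂ) else 0) + (if i = q j then (s j : ℂ) else 0)
  have hW : ∀ i j, star (W i j) = W i j := by
    intro i j
    simp only [W, star_add]
    split_ifs <;> simp
  have main := aux_sum p q (fun j => (c j : ℂ)) (fun j => (s j : ℂ)) hp hq hpq
  refine ⟨W, a, ?_, ?_⟩
  · ext j l
    have := main (fun _ => 1) j l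
    simp only [mul_one] at this
    rw [Matrix.mul_apply, Matrix.one_apply]
    simp only [conjTranspose_apply, hW]
    refine this.trans ?_
    have h := h1 j
    split_ifs
    · exact_mod_cast h
    · rfl
  · ext j l
    have := main (fun i => (d i : ℂ)) j l
    rw [Matrix.mul_apply, Matrix.smul_apply, Matrix.one_apply]
    simp only [mul_diagonal, conjTranspose_apply, hW]
    refine this.trans ?_
    have h := h2 j
    split_ifs
    · rw [smul_eq_mul, mul_one]; exact_mod_cast h
    · simp

lemma aux_herm {n m : ℕ} (hm : 1 ≤ m) (hmn : 2 * m ≤ n + 1) (A : Matrix (Fin n) (Fin n) ℂ)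
    (hA : A.IsHermitian) :
    ∃ (V : Matrix (Fin n) (Fin m) ℂ) (a : ℝ), Vᴴ * V = 1 ∧ Vᴴ * A * V = (a : ℂ) • 1 := by
  obtain ⟨W, a, h1, h2⟩ := aux_diag hm hmn hA.eigenvalues
  have hs := hA.spectral_theorem
  rw [Unitary.conjStarAlgAut_apply] at hs
  set U : Matrix (Fin n) (Fin n) ℂ := (hA.eigenvectorUnitary : Matrix (Fin n) (Fin n) ℂ)
  have hU : Uᴴ * U = 1 := Unitary.coe_star_mul_self hA.eigenvectorUnitary
  have hs' : A = U * diagonal (fun i => (hA.eigenvalues i : ℂ)) * Uᴴ := hs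
  refine ⟨U * W, a, ?_, ?_⟩
  · rw [conjTranspose_mul, Matrix.mul_assoc, ← Matrix.mul_assoc Uᴴ, hU, Matrix.one_mul, h1]
  · rw [← h2]
    generalize diagonal (fun i => (hA.eigenvalues i : ℂ)) = D at hs'
    rw [hs', conjTranspose_mul]
    calc Wᴴ * Uᴴ * (U * D * Uᴴ) * (U * W) = Wᴴ * (Uᴴ * U) * D * (Uᴴ * U) * W := by
          simp only [Matrix.mul_assoc]
      _ = _ := by rw [hU]; simp only [Matrix.mul_one]

/-- for any T and 4k − 3 ≤ N, Λ_k(T) is non-empty. -/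
theorem rankKRange_nonempty (N k : ℕ) (hk : 1 ≤ k) (hkN : 4 * k - 3 ≤ N)
    (T : Matrix (Fin N) (Fin N) ℂ) :
    (rankKRange k T).Nonempty := by
  obtain ⟨A, B, hA, hB, hT⟩ : ∃ A B : Matrix (Fin N) (Fin N) ℂ, A.IsHermitian ∧ B.IsHermitian ∧
      T = A + I • B := by
    refine ⟨(realPart T : Matrix _ _ ℂ), (imaginaryPart T : Matrix _ _ ℂ),
      (realPart T).2, (imaginaryPart T).2, (realPart_add_I_smul_imaginaryPart T).symm⟩
  obtain ⟨V, a, hV, hVA⟩ := aux_herm (m := 2 * k - 1) (by omega) (by omega) A hA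
  obtain ⟨W, b, hW, hWB⟩ := aux_herm (m := k) hk (by omega) (Vᴴ * B * V)
    (isHermitian_conjTranspose_mul_mul V hB)
  have hX : (V * W)ᴴ * (V * W) = 1 := by
    rw [conjTranspose_mul, Matrix.mul_assoc, ← Matrix.mul_assoc Vᴴ, hV, Matrix.one_mul, hW]
  have hXT : (V * W)ᴴ * T * (V * W) = ((a : ℂ) + I * b) • 1 := by
    have e : (V * W)ᴴ * T * (V * W) = Wᴴ * (Vᴴ * A * V) * W + I • (Wᴴ * (Vᴴ * B * V) * W) := by
      rw [hT, conjTranspose_mul]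
      simp only [Matrix.mul_add, Matrix.add_mul, Matrix.mul_smul, Matrix.smul_mul,
        Matrix.mul_assoc]
    rw [e, hVA, hWB, Matrix.mul_smul, Matrix.smul_mul, Matrix.mul_one, hW, smul_smul, add_smul]
  generalize V * W = X at hX hXT
  refine ⟨(a : ℂ) + I * b, X * Xᴴ, isHermitian_mul_conjTranspose_self X, ?_, ?_, ?_⟩
  · calc X * Xᴴ * (X * Xᴴ) = X * (Xᴴ * X) * Xᴴ := by simp only [Matrix.mul_assoc]
      _ = _ := by rw [hX, Matrix.mul_one]
  · open scoped ComplexOrder in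
    rw [rank_self_mul_conjTranspose, ← rank_conjTranspose_mul_self, hX, rank_one,
      Fintype.card_fin]
  · calc X * Xᴴ * T * (X * Xᴴ) = X * (Xᴴ * T * X) * Xᴴ := by simp only [Matrix.mul_assoc]
      _ = _ := by rw [hXT, Matrix.mul_smul, Matrix.smul_mul, Matrix.mul_one]
end
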